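/- Let n ≥ 1, let ω₁, …, ωₙ > 0 be linearly independent over ℚ, and let j ≥ 1 be an integer. Suppose complex numbers c_α for multi-indices α ∈ ℕⁿ with |α| = j+1, and d_β for β ∈ ℕⁿ with |β| = j−1, satisfy, for every t ∈ ℝ with sin(ωₖt/2) ≠ 0 for all k: Σ_{|α|=j+1} c_α Πₖ cot(ωₖt/2)^{αₖ} + Σ_{|β|=j−1} d_β Πₖ cot(ωₖt/2)^{βₖ} · ( (1/(3ωₙ²))·((2βₙ+5)/(βₙ+1))·( −cot(ωₙt/2)/(2ωₙ) )² + 1/(9ωₙ⁴) ) = 0. Then c_α = 0 for all α with |α| = j+1 and d_β = 0 for all β with |β| = j−1. -/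

import Mathlib

open scoped BigOperators

open MvPolynomial

/-- The character `t ↦ exp (i a t)` of the additive group of real numbers. -/
noncomputable def expCharacter (a : ℝ) : Multiplicative ℝ →* ℂ where
  toFun t := Complex.exp (Complex.I * a * (Multiplicative.toAdd t : ℝ))
  map_one' := by simp
  map_mul' s t := by
    rw [← Complex.exp_add, toAdd_mul]
    push_cast
    ring_nf

theorem expCharacter_injective : Function.Injective expCharacter := by
  intro a b hab
  by_contra hne
  have hsub : (a : ℂ) - b ≠ 0 := by
    rw [← Complex.ofReal_sub]
    exact_mod_cast sub_ne_zero.mpr hne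
  have key := DFunLike.congr_fun hab (Multiplicative.ofAdd (Real.pi / (a - b)))
  simp only [expCharacter, MonoidHom.coe_mk, OneHom.coe_mk, toAdd_ofAdd] at key
  rw [← div_eq_one_iff_eq (Complex.exp_ne_zero _), ← Complex.exp_sub] at key
  have harg : Complex.I * a * ((Real.pi / (a - b) : ℝ) : ℂ)
      - Complex.I * b * ((Real.pi / (a - b) : ℝ) : ℂ) = Real.pi * Complex.I := by
    push_cast
    field_simp
  rw [harg, Complex.exp_pi_mul_I] at key
  norm_num at key

/-- A polynomial vanishing along the linear flow with rationally independent frequencies on the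
torus is zero. -/
theorem MvPolynomial.eq_zero_of_eval_exp_eq_zero {ι : Type*} [Fintype ι] {ω : ι → ℝ}
    (hind : ∀ q : ι → ℚ, (∑ k, (q k : ℝ) * ω k) = 0 → ∀ k, q k = 0) (R : MvPolynomial ι ℂ)
    (hR : ∀ t : ℝ, eval (fun k => Complex.exp (Complex.I * ω k * t)) R = 0) : R = 0 := by
  have hinj : Function.Injective fun m : ι →₀ ℕ => expCharacter (∑ k, (m k : ℝ) * ω k) := by
    intro m m' hm
    have hsum : (∑ k, (m k : ℝ) * ω k) = ∑ k, (m' k : ℝ) * ω k := expCharacter_injective hm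
    ext k
    have hzero := hind (fun k => (m k : ℚ) - m' k) (by
      push_cast
      simp only [sub_mul, Finset.sum_sub_distrib]
      linarith) k
    exact_mod_cast sub_eq_zero.mp hzero
  have hli := (linearIndependent_monoidHom (Multiplicative ℝ) ℂ).comp _ hinj
  rw [linearIndependent_iff'] at hli
  have hcoeff := hli R.support (fun m => coeff m R) (by
    funext t
    have ht := hR (Multiplicative.toAdd t)
    rw [eval_eq'] at ht
    simp only [Finset.sum_apply, Pi.smul_apply, Function.comp_apply, smul_eq_mul, Pi.zero_apply]
    rw [← ht]
    refine Finset.sum_congr rfl fun m _ => ?_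
    congr 1
    simp only [expCharacter, MonoidHom.coe_mk, OneHom.coe_mk, ← Complex.exp_nat_mul,
      ← Complex.exp_sum]
    congr 1
    push_cast
    rw [Finset.mul_sum, Finset.sum_mul]
    refine Finset.sum_congr rfl fun k _ => ?_
    ring)
  ext m
  by_cases hm : m ∈ R.support
  · simpa using hcoeff m hm
  · simpa using hm

/-- Clearing denominators after substituting the Cayley transform in every variable. -/
theorem MvPolynomial.exists_eval_cayley_eq {ι : Type*} [Fintype ι] (P : MvPolynomial ι ℂ) :
    ∃ (Q : MvPolynomial ι ℂ) (N : ℕ), ∀ z : ι → ℂ, (∀ k, z k ≠ 1) →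
      eval z Q = (∏ k, (z k - 1)) ^ N *
        eval (fun k => Complex.I * (z k + 1) / (z k - 1)) P := by
  classical
  induction P using MvPolynomial.induction_on with
  | C a => exact ⟨C a, 0, fun z _ => by simp⟩
  | add p q hp hq =>
    obtain ⟨Q, N, hQ⟩ := hp
    obtain ⟨Q', N', hQ'⟩ := hq
    refine ⟨Q * (∏ k, (X k - 1)) ^ N' + Q' * (∏ k, (X k - 1)) ^ N, N + N', fun z hz => ?_⟩
    simp only [map_add, map_mul, map_pow, map_prod, map_sub, eval_X, map_one, hQ z hz, hQ' z hz]
    ring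
  | mul_X p i hp =>
    obtain ⟨Q, N, hQ⟩ := hp
    refine ⟨Q * (C Complex.I * (X i + 1) * ∏ k ∈ Finset.univ.erase i, (X k - 1)), N + 1,
      fun z hz => ?_⟩
    have hi : z i - 1 ≠ 0 := sub_ne_zero.mpr (hz i)
    simp only [map_add, map_mul, map_prod, map_sub, eval_X, eval_C, map_one, hQ z hz]
    rw [pow_succ, ← Finset.mul_prod_erase Finset.univ (fun k => z k - 1) (Finset.mem_univ i)]
    field_simp

theorem Complex.exp_sub_one_eq_two_mul_I_mul_sin (x : ℂ) :
    Complex.exp (2 * x * Complex.I) - 1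
      = 2 * Complex.I * Complex.sin x * Complex.exp (x * Complex.I) := by
  have hneg : Complex.exp (-x * Complex.I) * Complex.exp (x * Complex.I) = 1 := by
    rw [← Complex.exp_add]; simp
  have hsq : Complex.exp (2 * x * Complex.I) = Complex.exp (x * Complex.I) ^ 2 := by
    rw [← Complex.exp_nat_mul]; push_cast; ring_nf
  rw [Complex.sin, hsq]
  linear_combination (Complex.exp (x * Complex.I) ^ 2 - 1) * Complex.I_sq - Complex.I ^ 2 * hneg

theorem Complex.exp_add_one_eq_two_mul_cos (x : ℂ) :
    Complex.exp (2 * x * Complex.I) + 1 = 2 * Complex.cos x * Complex.exp (x * Complex.I) := by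
  have hneg : Complex.exp (-x * Complex.I) * Complex.exp (x * Complex.I) = 1 := by
    rw [← Complex.exp_add]; simp
  have hsq : Complex.exp (2 * x * Complex.I) = Complex.exp (x * Complex.I) ^ 2 := by
    rw [← Complex.exp_nat_mul]; push_cast; ring_nf
  rw [Complex.cos, hsq]
  linear_combination -hneg

/-- Cotangents with rationally independent frequencies are algebraically independent. -/
theorem MvPolynomial.eq_zero_of_eval_cot_eq_zero {ι : Type*} [Fintype ι] {ω : ι → ℝ}
    (hind : ∀ q : ι → ℚ, (∑ k, (q k : ℝ) * ω k) = 0 → ∀ k, q k = 0) (P : MvPolynomial ι ℂ)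
    (hP : ∀ t : ℝ, (∀ k, Real.sin (ω k * t / 2) ≠ 0) →
      eval (fun k => ((Real.cos (ω k * t / 2) / Real.sin (ω k * t / 2) : ℝ) : ℂ)) P = 0) :
    P = 0 := by
  obtain ⟨Q, N, hQ⟩ := P.exists_eval_cayley_eq
  have hprod (a : ℂ) : (∏ k : ι, (X k - C a) : MvPolynomial ι ℂ) ≠ 0 := by
    refine Finset.prod_ne_zero_iff.mpr fun k _ hk => ?_
    have := congrArg (eval fun _ => a + 1) hk
    simp at this
  have hQD : Q * ∏ k : ι, (X k - C 1) = 0 := by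
    refine eq_zero_of_eval_exp_eq_zero hind _ fun t => ?_
    have hfactor (k : ι) := Complex.exp_sub_one_eq_two_mul_I_mul_sin (ω k * t / 2)
    have hfactor' (k : ι) := Complex.exp_add_one_eq_two_mul_cos (ω k * t / 2)
    have harg (k : ι) : 2 * ((ω k : ℂ) * t / 2) * Complex.I = Complex.I * ω k * t := by ring
    simp only [harg] at hfactor hfactor'
    simp only [map_mul, map_prod, map_sub, eval_X, eval_C]
    by_cases hsin : ∀ k, Real.sin (ω k * t / 2) ≠ 0
    · have hsinC (k : ι) : Complex.sin (ω k * t / 2) ≠ 0 := by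
        have := hsin k
        rw [← Complex.ofReal_ne_zero] at this
        push_cast at this
        exact this
      rw [hQ]
      · have hcot : (fun k => Complex.I * (Complex.exp (Complex.I * ω k * t) + 1) /
            (Complex.exp (Complex.I * ω k * t) - 1)) =
            fun k => ((Real.cos (ω k * t / 2) / Real.sin (ω k * t / 2) : ℝ) : ℂ) := by
          funext k
          have hk := hsinC k
          have he := Complex.exp_ne_zero ((ω k : ℂ) * t / 2 * Complex.I)
          rw [hfactor, hfactor']
          push_cast
          generalize Complex.exp ((ω k : ℂ) * t / 2 * Complex.I) = e at he ⊢
          generalize Complex.sin ((ω k : ℂ) * t / 2) = s at hk ⊢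
          have hI := Complex.I_ne_zero
          field_simp
        rw [hcot, hP t hsin]
        simp
      · intro k
        rw [← sub_ne_zero, hfactor]
        exact mul_ne_zero (mul_ne_zero (mul_ne_zero two_ne_zero Complex.I_ne_zero) (hsinC k))
          (Complex.exp_ne_zero _)
    · push Not at hsin
      obtain ⟨k, hk⟩ := hsin
      have hkC : Complex.sin (ω k * t / 2) = 0 := by
        have := congrArg (fun x : ℝ => (x : ℂ)) hk
        push_cast at this
        exact this
      rw [Finset.prod_eq_zero (Finset.mem_univ k) (by rw [hfactor, hkC]; ring), mul_zero]
  have hQ0 : Q = 0 := (mul_eq_zero.mp hQD).resolve_right (hprod 1)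
  have hPD : P * ∏ k : ι, (X k - C Complex.I) = 0 := by
    refine MvPolynomial.funext fun x => ?_
    simp only [map_mul, map_prod, map_sub, eval_X, eval_C, map_zero]
    by_cases hx : ∀ k, x k - Complex.I ≠ 0
    · have hsub (k : ι) :
          (x k + Complex.I) / (x k - Complex.I) - 1 = 2 * Complex.I / (x k - Complex.I) := by
        have := hx k
        field_simp
        ring
      have hne (k : ι) : (x k + Complex.I) / (x k - Complex.I) - 1 ≠ 0 := by
        rw [hsub]
        exact div_ne_zero (mul_ne_zero two_ne_zero Complex.I_ne_zero) (hx k)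
      have hz := hQ (fun k => (x k + Complex.I) / (x k - Complex.I))
        fun k => sub_ne_zero.mp (hne k)
      have hinv : (fun k => Complex.I * ((x k + Complex.I) / (x k - Complex.I) + 1) /
          ((x k + Complex.I) / (x k - Complex.I) - 1)) = x := by
        funext k
        have := hx k
        have hI := Complex.I_ne_zero
        rw [hsub]
        field_simp
        ring
      rw [hinv, hQ0, map_zero, eq_comm, mul_eq_zero] at hz
      rw [hz.resolve_left (pow_ne_zero _ (Finset.prod_ne_zero_iff.mpr fun k _ => hne k)), zero_mul]
    · push Not at hx
      obtain ⟨k, hk⟩ := hx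
      rw [Finset.prod_eq_zero (Finset.mem_univ k) hk, mul_zero]
  exact (mul_eq_zero.mp hPD).resolve_right (hprod Complex.I)

/-- Linear independence of the combined family of cotangent monomials of degree `j+1`
together with the degree-`(j−1)` monomials multiplied by the factor
`(1/(3ωₙ²))((2βₙ+5)/(βₙ+1))(−cot(ωₙt/2)/(2ωₙ))² + 1/(9ωₙ⁴)`: if such a combination
vanishes for all admissible `t`, all coefficients vanish.  Here multi-indices of total
degree `m` are encoded by `Finset.Nat.antidiagonalTuple n m`, and `kn` is the last
index (the index of `ωₙ`). -/
theorem stmt_8 (n : ℕ) (hn : 1 ≤ n) (ω : Fin n → ℝ) (hω : ∀ k, 0 < ω k)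
    (hind : ∀ q : Fin n → ℚ, (∑ k, (q k : ℝ) * ω k) = 0 → ∀ k, q k = 0)
    (j : ℕ) (hj : 1 ≤ j)
    (kn : Fin n) (hkn : (kn : ℕ) = n - 1)
    (c d : (Fin n → ℕ) → ℂ)
    (h : ∀ t : ℝ, (∀ k, Real.sin (ω k * t / 2) ≠ 0) →
      (∑ α ∈ Finset.Nat.antidiagonalTuple n (j + 1), c α *
          ∏ k, ((Real.cos (ω k * t / 2) / Real.sin (ω k * t / 2) : ℝ) : ℂ) ^ (α k))
        + ∑ β ∈ Finset.Nat.antidiagonalTuple n (j - 1), d β *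
            (∏ k, ((Real.cos (ω k * t / 2) / Real.sin (ω k * t / 2) : ℝ) : ℂ) ^ (β k)) *
            ((1 / (3 * ω kn ^ 2) *
                ((2 * (β kn : ℝ) + 5) / ((β kn : ℝ) + 1)) *
                (-(Real.cos (ω kn * t / 2) / Real.sin (ω kn * t / 2)) / (2 * ω kn)) ^ 2
              + 1 / (9 * ω kn ^ 4) : ℝ) : ℂ)
        = 0) :
    (∀ α ∈ Finset.Nat.antidiagonalTuple n (j + 1), c α = 0) ∧
    (∀ β ∈ Finset.Nat.antidiagonalTuple n (j - 1), d β = 0) := by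
  classical
  let e : (Fin n → ℕ) → (Fin n →₀ ℕ) := Finsupp.equivFunOnFinite.symm
  have he : Function.Injective e := Finsupp.equivFunOnFinite.symm.injective
  let a : (Fin n → ℕ) → ℂ := fun β =>
    (1 / (3 * ω kn ^ 2) * ((2 * (β kn : ℝ) + 5) / ((β kn : ℝ) + 1)) / (2 * ω kn) ^ 2 : ℝ)
  let b : ℂ := (1 / (9 * ω kn ^ 4) : ℝ)
  have hb : b ≠ 0 := by
    have := hω kn
    exact Complex.ofReal_ne_zero.mpr (by positivity)
  let P : MvPolynomial (Fin n) ℂ :=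
    ∑ α ∈ Finset.Nat.antidiagonalTuple n (j + 1), monomial (e α) (c α)
      + ∑ β ∈ Finset.Nat.antidiagonalTuple n (j - 1),
          (monomial (e β + Finsupp.single kn 2) (d β * a β) + monomial (e β) (d β * b))
  have heval (x : Fin n → ℂ) (α : Fin n → ℕ) (r : ℂ) :
      eval x (monomial (e α) r) = r * ∏ k, x k ^ α k := by
    rw [eval_monomial, Finsupp.prod_fintype _ _ (by simp)]
    rfl
  have hP : P = 0 := by
    refine eq_zero_of_eval_cot_eq_zero hind P fun t ht => ?_
    rw [← h t ht]
    simp only [P, map_add, map_sum]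
    congr 1
    · exact Finset.sum_congr rfl fun α _ => heval _ _ _
    · refine Finset.sum_congr rfl fun β _ => ?_
      rw [← mul_one (d β * a β), ← monomial_mul, map_mul, heval, heval, eval_monomial,
        Finsupp.prod_single_index (by simp)]
      simp only [a, b]
      push_cast
      ring
  have hdeg (m : ℕ) (α : Fin n → ℕ) :
      α ∈ Finset.Nat.antidiagonalTuple n m ↔ (e α).degree = m := by
    rw [Finset.Nat.mem_antidiagonalTuple, Finsupp.degree_eq_sum]
    rfl
  have hd : ∀ β ∈ Finset.Nat.antidiagonalTuple n (j - 1), d β = 0 := by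
    intro β hβ
    have hcoeff : coeff (e β) P = d β * b := by
      simp only [P, coeff_add, coeff_sum, coeff_monomial]
      rw [Finset.sum_eq_zero, Finset.sum_eq_single_of_mem β hβ]
      · simp
      · intro γ hγ hne
        rw [if_neg, if_neg (he.ne hne), add_zero]
        intro heq
        have := congrArg Finsupp.degree heq
        rw [map_add, (hdeg _ _).mp hγ, (hdeg _ _).mp hβ, Finsupp.degree_single] at this
        omega
      · intro α hα
        rw [if_neg]
        intro heq
        have := congrArg Finsupp.degree heq
        rw [(hdeg _ _).mp hα, (hdeg _ _).mp hβ] at this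
        omega
    rw [hP, coeff_zero, eq_comm, mul_eq_zero] at hcoeff
    exact hcoeff.resolve_right hb
  refine ⟨fun α hα => ?_, hd⟩
  have hcoeff : coeff (e α) P = c α := by
    simp only [P, coeff_add, coeff_sum, coeff_monomial]
    rw [Finset.sum_eq_single_of_mem α hα fun γ _ hne => if_neg (he.ne hne),
      Finset.sum_eq_zero fun γ hγ => by simp [hd γ hγ]]
    simp
  rw [← hcoeff, hP, coeff_zero]
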